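/- Let E be a normed vector space and g : ℝ^d → E an n-times continuously differentiable function. For ξ₀, ξ₁, …, ξ_n ∈ ℝ^d define the iterated difference Δ_n g(ξ₀; ξ₁,…,ξ_n) := Σ_{J⊆{1,…,n}} (−1)^{|J|} g(ξ₀ + Σ_{j∈J} ξ_j), and let K be the convex hull of the 2^n points { ξ₀ + Σ_{j∈J} ξ_j : J ⊆ {1,…,n} }. Then ‖Δ_n g(ξ₀; ξ₁,…,ξ_n)‖ ≤ (∏_{j=1}^n |ξ_j|) · sup_{η∈K} ‖D^n g(η)‖, where D^n g denotes the n-th (Fréchet) derivative of g and ‖D^n g(η)‖ its operator norm. -/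

import Mathlib

open MeasureTheory Real Finset

noncomputable section

abbrev Rd (d : ℕ) := EuclideanSpace ℝ (Fin d)

/-- If the derivative of order `#s` of `g` is bounded by `C` on the convex hull of the points
`x + ∑ j ∈ J, ξ j`, `J ⊆ s`, then the iterated difference of `g` at `x` with increments `ξ j`,
`j ∈ s`, is bounded by `(∏ j ∈ s, ‖ξ j‖) * C`. -/
theorem norm_sum_powerset_neg_one_pow_smul_le {ι F E : Type*} [NormedAddCommGroup F]
    [NormedSpace ℝ F] [NormedAddCommGroup E] [NormedSpace ℝ E] (ξ : ι → F) (x : F)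
    (s : Finset ι) (g : F → E) (hg : ContDiff ℝ s.card g) (C : ℝ)
    (hC : ∀ η ∈ convexHull ℝ {η : F | ∃ J ⊆ s, η = x + ∑ j ∈ J, ξ j},
      ‖iteratedFDeriv ℝ s.card g η‖ ≤ C) :
    ‖∑ J ∈ s.powerset, ((-1 : ℝ) ^ J.card) • g (x + ∑ j ∈ J, ξ j)‖ ≤ (∏ j ∈ s, ‖ξ j‖) * C := by
  classical
  induction s using Finset.induction_on generalizing g C with
  | empty =>
    have h := hC x (subset_convexHull ℝ _ ⟨∅, by simp⟩)
    rw [Finset.card_empty, norm_iteratedFDeriv_zero] at h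
    simpa using h
  | insert a s ha ih =>
    rw [Finset.card_insert_of_notMem ha] at hg hC
    set K := convexHull ℝ {η : F | ∃ J ⊆ insert a s, η = x + ∑ j ∈ J, ξ j}
    have hgs : ContDiff ℝ s.card g := hg.of_le (by exact_mod_cast Nat.le_succ _)
    have hgt : ContDiff ℝ s.card (fun y => g (y + ξ a)) := hgs.comp (by fun_prop)
    have hleft : convexHull ℝ {η : F | ∃ J ⊆ s, η = x + ∑ j ∈ J, ξ j} ⊆ K :=
      convexHull_mono fun η ⟨J, hJ, h⟩ => ⟨J, hJ.trans (Finset.subset_insert a s), h⟩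
    have hright : convexHull ℝ {η : F | ∃ J ⊆ s, η = x + ∑ j ∈ J, ξ j} ⊆
        (fun η => η + ξ a) ⁻¹' K := by
      refine convexHull_min ?_ ((convex_convexHull ℝ _).translate_preimage_left _)
      rintro η ⟨J, hJ, rfl⟩
      refine subset_convexHull ℝ _ ⟨insert a J, Finset.insert_subset_insert a hJ, ?_⟩
      rw [Finset.sum_insert fun h => ha (hJ h)]
      exact (add_right_comm _ _ _).trans (add_assoc _ _ _)
    have key := ih (fun y => g y - g (y + ξ a)) (hgs.sub hgt) (C * ‖ξ a‖) fun η hη => by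
      have hmv := (convex_convexHull ℝ _).norm_image_sub_le_of_norm_fderiv_le (𝕜 := ℝ)
        (f := iteratedFDeriv ℝ s.card g) (s := K) (C := C)
        (fun y _ => (hg.differentiable_iteratedFDeriv (by exact_mod_cast Nat.lt_succ_self _)) y)
        (fun y hy => by rw [norm_fderiv_iteratedFDeriv]; exact hC y hy) (hright hη) (hleft hη)
      rw [fun_iteratedFDeriv_sub_apply hgs.contDiffAt hgt.contDiffAt,
        iteratedFDeriv_comp_add_right]
      simpa using hmv
    rw [Finset.sum_powerset_insert ha, Finset.prod_insert ha, ← Finset.sum_add_distrib]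
    convert key using 1
    · congr 1
      refine Finset.sum_congr rfl fun J hJ => ?_
      have haJ : a ∉ J := fun h => ha (Finset.mem_powerset.1 hJ h)
      rw [Finset.card_insert_of_notMem haJ, Finset.sum_insert haJ, pow_succ, mul_neg_one,
        neg_smul, smul_sub, sub_eq_add_neg, add_comm (ξ a), add_assoc]
    · ring

/-- iterated difference estimate: for a `C^n` map `g : ℝ^d → E`,
`‖Δ_n g(ξ₀;ξ₁,…,ξ_n)‖ ≤ (∏|ξ_j|) ⨆_{η ∈ K} ‖D^n g(η)‖`, where
`Δ_n g(ξ₀;ξ₁,…,ξ_n) = Σ_{J⊆{1,…,n}} (−1)^{|J|} g(ξ₀+Σ_{j∈J}ξ_j)` and `K` is the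
convex hull of the points `ξ₀+Σ_{j∈J}ξ_j`. -/
theorem statement3 {d : ℕ} {E : Type*} [NormedAddCommGroup E] [NormedSpace ℝ E]
    (n : ℕ) (g : Rd d → E) (hg : ContDiff ℝ n g) (ξ0 : Rd d) (ξ : Fin n → Rd d) :
    ‖∑ J : Finset (Fin n), ((-1 : ℝ) ^ J.card) • g (ξ0 + ∑ j ∈ J, ξ j)‖
      ≤ (∏ j, ‖ξ j‖) *
        ⨆ η ∈ convexHull ℝ {η : Rd d | ∃ J : Finset (Fin n), η = ξ0 + ∑ j ∈ J, ξ j},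
          ‖iteratedFDeriv ℝ n g η‖ := by
  have hfin : {η : Rd d | ∃ J : Finset (Fin n), η = ξ0 + ∑ j ∈ J, ξ j}.Finite :=
    (Set.finite_range fun J : Finset (Fin n) => ξ0 + ∑ j ∈ J, ξ j).subset
      fun η ⟨J, h⟩ => ⟨J, h.symm⟩
  obtain ⟨M, hM⟩ := (hfin.isCompact_convexHull ℝ).exists_bound_of_continuousOn
    (hg.continuous_iteratedFDeriv le_rfl).continuousOn
  have hbdd : BddAbove (Set.range fun η : Rd d =>
      ⨆ _ : η ∈ convexHull ℝ {η : Rd d | ∃ J : Finset (Fin n), η = ξ0 + ∑ j ∈ J, ξ j},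
        ‖iteratedFDeriv ℝ n g η‖) := by
    refine ⟨max M 0, ?_⟩
    rintro _ ⟨η, rfl⟩
    exact Real.iSup_le (fun h => (hM η h).trans (le_max_left _ _)) (le_max_right _ _)
  have hcard : (Finset.univ : Finset (Fin n)).card = n := Finset.card_fin n
  have key := norm_sum_powerset_neg_one_pow_smul_le ξ ξ0 Finset.univ g (by rwa [hcard])
    (⨆ η ∈ convexHull ℝ {η : Rd d | ∃ J : Finset (Fin n), η = ξ0 + ∑ j ∈ J, ξ j},
      ‖iteratedFDeriv ℝ n g η‖) fun η hη => by
    simp only [Finset.subset_univ, true_and] at hη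
    rw [hcard]
    refine le_trans ?_ (le_ciSup hbdd η)
    simp only [hη, ciSup_unique, le_refl]
  simpa only [Finset.powerset_univ] using key
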